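/- Fix d ∈ N and s > 0. Then for every 0 < r < ∞ one has the limit lim_{n→∞} n^{s/d} · a_n(I_d : H^{s,r}(T^d) → L₂(T^d)) = vol(B_r^d)^{s/d}, where I_d denotes the embedding of H^{s,r}(T^d) into L₂(T^d). -/

import Mathlib

open MeasureTheory Filter
open scoped ENNReal NNReal

noncomputable section

/-- The index lattice `ℤ^d`. -/
abbrev ZLat (d : ℕ) := Fin d → ℤ

instance fact_two_pi_pos : Fact (0 < 2 * Real.pi) := ⟨by positivity⟩

/-- The `d`-dimensional torus `𝕋^d = [0,2π]^d` with endpoints identified. -/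
abbrev Torus (d : ℕ) := Fin d → AddCircle (2 * Real.pi)

/-- The normalized Lebesgue measure `(2π)^{-d} dx` on the `d`-torus. -/
def torusMeasure (d : ℕ) : Measure (Torus d) :=
  ((ENNReal.ofReal (2 * Real.pi))⁻¹) ^ d • Measure.pi fun _ => volume

/-- The character `e^{i k·x}` on the `d`-torus. -/
def torusChar {d : ℕ} (k : ZLat d) (x : Torus d) : ℂ :=
  ∏ j, fourier (k j) (x j)

/-- The `k`-th Fourier coefficient `f̂(k) = (2π)^{-d} ∫_{𝕋^d} f(x) e^{-i k·x} dx`. -/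
def fourierCoef {d : ℕ} (f : Torus d → ℂ) (k : ZLat d) : ℂ :=
  ∫ x, (starRingEnd ℂ) (torusChar k x) * f x ∂(torusMeasure d)

/-- The `n`-th approximation number of a bounded linear operator `T`:
`a_n(T) = inf {‖T - A‖ : rank A < n}`. -/
def approxNum {X Y : Type*} [NormedAddCommGroup X] [NormedSpace ℂ X]
    [NormedAddCommGroup Y] [NormedSpace ℂ Y] (T : X →L[ℂ] Y) (n : ℕ) : ℝ :=
  sInf {c : ℝ | ∃ A : X →L[ℂ] Y,
    Module.rank ℂ (LinearMap.range (A : X →ₗ[ℂ] Y)) < n ∧ c = ‖T - A‖}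

/-- `ℓ²(ℤ^d)`; an isometric model of the Hilbert space `F_d(w)` via `f ↦ (w(k)·f̂(k))_k`.
Under this identification the embedding `I_d : F_d(w) → G` is characterized by the
property that the function `T c` has Fourier coefficients `c(k)/w(k)`. -/
abbrev ellTwo (d : ℕ) := lp (fun _ : ZLat d => ℂ) 2

/-- `ℓ¹(ℤ^d)`; an isometric model of the Wiener algebra `A(𝕋^d)` via `f ↦ (f̂(k))_k`. -/
abbrev ellOne (d : ℕ) := lp (fun _ : ZLat d => ℂ) 1

/-- `ℓ^∞(ℤ^d)`; an isometric model of the space `ℬ(𝕋^d)` of distributions with bounded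
Fourier coefficients. -/
abbrev ellInfty (d : ℕ) := lp (fun _ : ZLat d => ℂ) ⊤

/-- The weight `w_{s,r}(k) = (1 + ∑_j |k_j|^r)^{s/r}` of the isotropic Sobolev space
`H^{s,r}(𝕋^d) = F_d(w_{s,r})`. -/
def wIso (d : ℕ) (s r : ℝ) (k : ZLat d) : ℝ := (1 + ∑ j, |(k j : ℝ)| ^ r) ^ (s / r)

section FourierBasis

variable {d : ℕ}

theorem torusMeasure_eq_pi (d : ℕ) :
    torusMeasure d =
      Measure.pi fun _ => (AddCircle.haarAddCircle : Measure (AddCircle (2 * Real.pi))) := by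
  have h2 : ENNReal.ofReal (2 * Real.pi) ≠ 0 := by
    simpa using Real.pi_pos
  refine (Measure.pi_eq fun s hs => ?_).symm
  rw [torusMeasure, Measure.smul_apply, Measure.pi_pi, smul_eq_mul]
  simp only [AddCircle.volume_eq_smul_haarAddCircle, Measure.smul_apply, smul_eq_mul,
    Finset.prod_mul_distrib, Finset.prod_const, Finset.card_univ, Fintype.card_fin]
  rw [← mul_assoc, ← mul_pow, ENNReal.inv_mul_cancel h2 ENNReal.ofReal_ne_top, one_pow, one_mul]

instance isProbabilityMeasure_torusMeasure (d : ℕ) : IsProbabilityMeasure (torusMeasure d) := by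
  rw [torusMeasure_eq_pi]
  infer_instance

/-- The character `torusChar k` as a continuous function. -/
def torusMonomial (k : ZLat d) : C(Torus d, ℂ) where
  toFun := torusChar k
  continuous_toFun := by unfold torusChar; fun_prop

theorem torusMonomial_apply (k : ZLat d) (x : Torus d) : torusMonomial k x = torusChar k x := rfl

theorem torusChar_neg (k : ZLat d) (x : Torus d) :
    torusChar (-k) x = (starRingEnd ℂ) (torusChar k x) := by
  simp only [torusChar, Pi.neg_apply, fourier_neg, map_prod]

theorem torusChar_zero (x : Torus d) : torusChar 0 x = 1 := by
  simp [torusChar]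

theorem torusChar_add (k l : ZLat d) (x : Torus d) :
    torusChar (k + l) x = torusChar k x * torusChar l x := by
  simp only [torusChar, Pi.add_apply, fourier_add, Finset.prod_mul_distrib]

theorem torusChar_single (i : Fin d) (x : Torus d) :
    torusChar (Pi.single i 1) x = fourier 1 (x i) := by
  rw [torusChar, Finset.prod_eq_single i]
  · rw [Pi.single_eq_same]
  · intro j _ hj
    rw [Pi.single_eq_of_ne hj, fourier_zero]
  · simp

/-- The star subalgebra of `C(Torus d, ℂ)` generated by the monomials. -/
def torusSubalgebra (d : ℕ) : StarSubalgebra ℂ C(Torus d, ℂ) where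
  toSubalgebra := Algebra.adjoin ℂ (Set.range torusMonomial)
  star_mem' := by
    change Algebra.adjoin ℂ (Set.range torusMonomial) ≤
      star (Algebra.adjoin ℂ (Set.range torusMonomial))
    refine Algebra.adjoin_le ?_
    rintro _ ⟨k, rfl⟩
    refine Algebra.subset_adjoin ⟨-k, ?_⟩
    ext1 x
    exact torusChar_neg k x

theorem torusSubalgebra_toSubmodule (d : ℕ) :
    (torusSubalgebra d).toSubalgebra.toSubmodule = Submodule.span ℂ (Set.range torusMonomial) := by
  apply Algebra.adjoin_eq_span_of_subset
  refine .trans (fun x => Submonoid.closure_induction (fun _ => id) ⟨0, ?_⟩ ?_)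
    Submodule.subset_span
  · ext x
    exact torusChar_zero x
  · rintro _ _ _ _ ⟨k, rfl⟩ ⟨l, rfl⟩
    refine ⟨k + l, ?_⟩
    ext x
    exact torusChar_add k l x

theorem torusSubalgebra_separatesPoints (d : ℕ) : (torusSubalgebra d).SeparatesPoints := by
  intro x y hxy
  obtain ⟨i, hi⟩ := Function.ne_iff.mp hxy
  refine ⟨_, ⟨torusMonomial (Pi.single i 1), Algebra.subset_adjoin ⟨Pi.single i 1, rfl⟩, rfl⟩, ?_⟩
  dsimp only
  rw [torusMonomial_apply, torusMonomial_apply, torusChar_single, torusChar_single, fourier_one,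
    fourier_one]
  contrapose! hi
  exact AddCircle.injective_toCircle (by positivity) (Circle.ext hi)

theorem span_torusMonomial_closure_eq_top (d : ℕ) :
    (Submodule.span ℂ (Set.range (torusMonomial (d := d)))).topologicalClosure = ⊤ := by
  rw [← torusSubalgebra_toSubmodule]
  exact congr_arg (Subalgebra.toSubmodule <| StarSubalgebra.toSubalgebra ·)
    (ContinuousMap.starSubalgebra_topologicalClosure_eq_top_of_separatesPoints _
      (torusSubalgebra_separatesPoints d))

/-- The character `torusChar k` as an element of `L²`. -/
def torusMonomialLp (k : ZLat d) : Lp ℂ 2 (torusMeasure d) :=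
  ContinuousMap.toLp (E := ℂ) 2 (torusMeasure d) ℂ (torusMonomial k)

theorem span_torusMonomialLp_closure_eq_top (d : ℕ) :
    (Submodule.span ℂ (Set.range (torusMonomialLp (d := d)))).topologicalClosure = ⊤ := by
  have h := (ContinuousMap.toLp_denseRange ℂ (torusMeasure d) ℂ
    (p := 2) (by simp)).topologicalClosure_map_submodule (span_torusMonomial_closure_eq_top d)
  rw [Submodule.map_span, ← Set.range_comp] at h
  exact h

theorem integral_torusChar (k : ZLat d) :
    ∫ x, torusChar k x ∂torusMeasure d = if k = 0 then 1 else 0 := by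
  split_ifs with h
  · simp [h, torusChar_zero]
  · obtain ⟨i, hi⟩ := Function.ne_iff.mp h
    simp only [torusChar, torusMeasure_eq_pi]
    rw [integral_fintype_prod_eq_prod (fun j (y : AddCircle (2 * Real.pi)) => fourier (k j) y)]
    refine Finset.prod_eq_zero (Finset.mem_univ i) ?_
    have hi' : 0 ≠ k i := Ne.symm hi
    have := (orthonormal_iff_ite.mp (orthonormal_fourier (T := 2 * Real.pi))) 0 (k i)
    simpa [ContinuousMap.inner_toLp, hi'] using this

theorem orthonormal_torusMonomialLp (d : ℕ) : Orthonormal ℂ (torusMonomialLp (d := d)) := by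
  rw [orthonormal_iff_ite]
  intro k l
  simp only [torusMonomialLp, ContinuousMap.inner_toLp, torusMonomial_apply, ← torusChar_neg,
    ← torusChar_add, integral_torusChar]
  refine if_congr ?_ rfl rfl
  rw [← sub_eq_add_neg, sub_eq_zero, eq_comm]

/-- The Hilbert basis of `L²(𝕋^d)` given by the characters. -/
def torusBasis (d : ℕ) : HilbertBasis (ZLat d) ℂ (Lp ℂ 2 (torusMeasure d)) :=
  HilbertBasis.mk (orthonormal_torusMonomialLp d) (span_torusMonomialLp_closure_eq_top d).ge

theorem torusBasis_repr (f : Lp ℂ 2 (torusMeasure d)) (k : ZLat d) :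
    (torusBasis d).repr f k = fourierCoef f k := by
  rw [(torusBasis d).repr_apply_apply, torusBasis, HilbertBasis.coe_mk, L2.inner_def]
  apply integral_congr_ae
  filter_upwards [ContinuousMap.coeFn_toLp (p := 2) (𝕜 := ℂ) (torusMeasure d) (torusMonomial k)]
    with x hx
  rw [torusMonomialLp, hx, RCLike.inner_apply, mul_comm, torusMonomial_apply]

end FourierBasis

section DiagonalOperator

universe u

variable {ι : Type u}

theorem lp_two_norm_le_mul {f g : lp (fun _ : ι => ℂ) 2} {C : ℝ} (hC : 0 ≤ C)
    (h : ∀ i, ‖f i‖ ≤ C * ‖g i‖) : ‖f‖ ≤ C * ‖g‖ := by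
  have hnorm : ‖f‖ ≤ ‖(C : ℂ) • g‖ := by
    refine lp.norm_mono (by simp) fun i => ?_
    rw [lp.coeFn_smul, Pi.smul_apply, norm_smul, Complex.norm_real, Real.norm_of_nonneg hC]
    exact h i
  rwa [norm_smul, Complex.norm_real, Real.norm_of_nonneg hC] at hnorm

/-- Division by a weight bounded below by `1` is a bounded diagonal operator on `ℓ²`. -/
theorem exists_diagonal_operator {w : ι → ℝ} (hw : ∀ i, 1 ≤ w i) :
    ∃ D : lp (fun _ : ι => ℂ) 2 →L[ℂ] lp (fun _ : ι => ℂ) 2, ∀ c i, D c i = c i / (w i : ℂ) := by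
  have hle : ∀ (c : lp (fun _ : ι => ℂ) 2) i, ‖c i / (w i : ℂ)‖ ≤ ‖c i‖ := fun c i => by
    rw [norm_div, Complex.norm_real, Real.norm_of_nonneg (zero_le_one.trans (hw i))]
    exact div_le_self (norm_nonneg _) (hw i)
  let D : lp (fun _ : ι => ℂ) 2 →ₗ[ℂ] lp (fun _ : ι => ℂ) 2 :=
    { toFun := fun c => ⟨fun i => c i / (w i : ℂ), (lp.memℓp c).mono' (hle c)⟩
      map_add' := fun c c' => by
        ext i
        exact add_div _ _ _
      map_smul' := fun a c => by
        ext i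
        exact mul_div_assoc _ _ _ }
  refine ⟨D.mkContinuous 1 fun c => lp_two_norm_le_mul zero_le_one fun i => ?_, fun c i => rfl⟩
  rw [one_mul]
  exact hle c i

variable {H : Type u} [NormedAddCommGroup H] [NormedSpace ℂ H] [DecidableEq ι]
  {T : lp (fun _ : ι => ℂ) 2 →L[ℂ] H} {J : H →ₗᵢ[ℂ] lp (fun _ : ι => ℂ) 2} {w : ι → ℝ}

/-- The embedding of `ℂ^S` into `ℓ²` by extension by zero. -/
def extendZero (S : Finset ι) : (S → ℂ) →ₗ[ℂ] lp (fun _ : ι => ℂ) 2 :=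
  ∑ i : S, (lp.lsingle 2 (i : ι)).comp (LinearMap.proj i)

theorem extendZero_apply (S : Finset ι) (x : S → ℂ) (i : ι) :
    extendZero S x i = if h : i ∈ S then x ⟨i, h⟩ else 0 := by
  have h1 : extendZero S x = ∑ j : S, lp.single 2 (j : ι) (x j) := by
    simp only [extendZero, LinearMap.sum_apply]
    rfl
  rw [h1, lp.coeFn_sum, Finset.sum_apply]
  simp only [lp.single_apply]
  split_ifs with h
  · rw [Finset.sum_eq_single ⟨i, h⟩]
    · simp
    · intro j _ hj
      exact Pi.single_eq_of_ne (fun h => hj (Subtype.ext h.symm)) _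
    · simp
  · refine Finset.sum_eq_zero fun j _ => Pi.single_eq_of_ne ?_ _
    rintro rfl
    exact h j.2

theorem bddBelow_norm_sub_of_rank_lt {X Y : Type*} [NormedAddCommGroup X] [NormedSpace ℂ X]
    [NormedAddCommGroup Y] [NormedSpace ℂ Y] (T : X →L[ℂ] Y) (n : ℕ) :
    BddBelow {c : ℝ | ∃ A : X →L[ℂ] Y,
      Module.rank ℂ (LinearMap.range (A : X →ₗ[ℂ] Y)) < n ∧ c = ‖T - A‖} := by
  refine ⟨0, ?_⟩
  rintro _ ⟨A, -, rfl⟩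
  exact norm_nonneg _

/-- If fewer than `n` weights are smaller than `t`, then `a_n ≤ 1 / t`. -/
theorem approxNum_le_inv (hT : ∀ c i, J (T c) i = c i / (w i : ℂ)) {t : ℝ} (ht : 0 < t)
    {S : Finset ι} {n : ℕ} (hS : S.card < n) (hSw : ∀ i ∉ S, t ≤ w i) :
    approxNum T n ≤ t⁻¹ := by
  let P : lp (fun _ : ι => ℂ) 2 →L[ℂ] lp (fun _ : ι => ℂ) 2 :=
    (extendZero S).toContinuousLinearMap.comp
      (ContinuousLinearMap.pi fun i : S => lp.evalCLM ℂ (fun _ : ι => ℂ) 2 (i : ι))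
  have hP : ∀ c j, P c j = if j ∈ S then c j else 0 := fun c j => by
    refine (extendZero_apply S _ j).trans ?_
    split_ifs <;> rfl
  refine (csInf_le (bddBelow_norm_sub_of_rank_lt T n) ⟨T.comp P, ?_, rfl⟩).trans ?_
  · have hle : LinearMap.range ((T.comp P : _ →L[ℂ] H) : lp (fun _ : ι => ℂ) 2 →ₗ[ℂ] H) ≤
        LinearMap.range ((T : lp (fun _ : ι => ℂ) 2 →ₗ[ℂ] H).comp (extendZero S)) := by
      rintro _ ⟨c, rfl⟩
      exact ⟨fun i => c i, rfl⟩
    refine (Submodule.rank_mono hle).trans_lt ((LinearMap.rank_le_domain _).trans_lt ?_)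
    rw [rank_fun', Fintype.card_coe]
    exact_mod_cast hS
  · refine ContinuousLinearMap.opNorm_le_bound _ (inv_nonneg.2 ht.le) fun c => ?_
    rw [← J.norm_map]
    refine lp_two_norm_le_mul (inv_nonneg.2 ht.le) fun i => ?_
    have : J ((T - T.comp P) c) i = (c - P c) i / (w i : ℂ) := by
      rw [← hT, map_sub]
      rfl
    rw [this, lp.coeFn_sub, Pi.sub_apply, hP]
    split_ifs with hi
    · simp only [sub_self, zero_div, norm_zero]
      positivity
    · rw [sub_zero, norm_div, Complex.norm_real, Real.norm_of_nonneg (ht.le.trans (hSw i hi)),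
        div_eq_inv_mul]
      gcongr
      exact hSw i hi

/-- If at least `n` weights are at most `t`, then `a_n ≥ 1 / t`. -/
theorem inv_le_approxNum (hw : ∀ i, 0 < w i) (hT : ∀ c i, J (T c) i = c i / (w i : ℂ)) {t : ℝ}
    (ht : 0 < t) {S : Finset ι} {n : ℕ} (hn : 0 < n) (hS : n ≤ S.card)
    (hSw : ∀ i ∈ S, w i ≤ t) : t⁻¹ ≤ approxNum T n := by
  refine le_csInf ⟨_, 0, ?_, rfl⟩ ?_
  · rw [ContinuousLinearMap.toLinearMap_zero, LinearMap.range_zero, rank_bot]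
    exact_mod_cast hn
  rintro _ ⟨A, hA, rfl⟩
  obtain ⟨x, hx, hx0⟩ : ∃ x, A (extendZero S x) = 0 ∧ x ≠ 0 := by
    by_contra! hcon
    have hinj : Function.Injective
        ((A : lp (fun _ : ι => ℂ) 2 →ₗ[ℂ] H).comp (extendZero S)) :=
      (injective_iff_map_eq_zero _).2 hcon
    have h1 := (rank_range_of_injective _ hinj).symm.trans_le
      (LinearMap.rank_comp_le_left (extendZero S) (A : lp (fun _ : ι => ℂ) 2 →ₗ[ℂ] H))
    rw [rank_fun', Fintype.card_coe] at h1
    exact absurd (h1.trans_lt hA) (by simpa using hS)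
  have hLx : extendZero S x ≠ 0 := fun h0 => hx0 <| funext fun i => by
    have h1 := extendZero_apply S x i
    rw [h0, dif_pos i.2] at h1
    exact h1.symm
  have key : ‖extendZero S x‖ ≤ t * ‖T (extendZero S x)‖ := by
    rw [← J.norm_map (T (extendZero S x))]
    refine lp_two_norm_le_mul ht.le fun i => ?_
    rw [hT, norm_div, Complex.norm_real, Real.norm_of_nonneg (hw i).le]
    by_cases hi : i ∈ S
    · rw [mul_div_left_comm]
      exact le_mul_of_one_le_right (norm_nonneg _) ((one_le_div (hw i)).2 (hSw i hi))
    · simp [extendZero_apply, hi]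
  have h2 := (T - A).le_opNorm (extendZero S x)
  rw [sub_apply, hx, sub_zero] at h2
  have h3 : 0 < ‖extendZero S x‖ := norm_pos_iff.2 hLx
  rw [inv_le_iff_one_le_mul₀' ht]
  nlinarith

end DiagonalOperator

section LatticeCount

open scoped Pointwise

variable {d : ℕ} {r : ℝ}

/-- The closed unit ball of the `ℓ^r` quasi-norm. -/
def rBall (d : ℕ) (r : ℝ) : Set (Fin d → ℝ) := {x | ∑ j, |x j| ^ r ≤ 1}

theorem continuous_sum_abs_rpow (hr : 0 < r) :
    Continuous fun x : Fin d → ℝ => ∑ j, |x j| ^ r :=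
  continuous_finsetSum _ fun j _ => (continuous_apply j).abs.rpow_const fun _ => Or.inr hr.le

theorem sum_abs_smul_rpow {c : ℝ} (hc : 0 ≤ c) (x : Fin d → ℝ) :
    ∑ j, |(c • x) j| ^ r = c ^ r * ∑ j, |x j| ^ r := by
  rw [Finset.mul_sum]
  refine Finset.sum_congr rfl fun j _ => ?_
  rw [Pi.smul_apply, smul_eq_mul, abs_mul, abs_of_nonneg hc, Real.mul_rpow hc (abs_nonneg _)]

theorem isClosed_rBall (hr : 0 < r) : IsClosed (rBall d r) :=
  isClosed_le (continuous_sum_abs_rpow hr) continuous_const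

theorem abs_le_of_sum_abs_rpow_le (hr : 0 < r) {R : ℝ} (hR : 0 ≤ R) {x : Fin d → ℝ}
    (hx : ∑ j, |x j| ^ r ≤ R ^ r) (j : Fin d) : |x j| ≤ R :=
  (Real.rpow_le_rpow_iff (abs_nonneg _) hR hr).1 <|
    (Finset.single_le_sum (f := fun j => |x j| ^ r)
      (fun _ _ => Real.rpow_nonneg (abs_nonneg _) _) (Finset.mem_univ j)).trans hx

theorem isBounded_rBall (hr : 0 < r) : Bornology.IsBounded (rBall d r) := by
  refine (Metric.isBounded_closedBall (x := (0 : Fin d → ℝ)) (r := 1)).subset fun x hx => ?_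
  rw [mem_closedBall_zero_iff, pi_norm_le_iff_of_nonneg zero_le_one]
  exact abs_le_of_sum_abs_rpow_le hr zero_le_one (by simpa [rBall] using hx)

theorem volume_rBall_ne_top (hr : 0 < r) : volume (rBall d r) ≠ ∞ :=
  (isBounded_rBall hr).measure_lt_top.ne

theorem volume_rBall_pos (hr : 0 < r) : 0 < volume (rBall d r) := by
  have hopen : IsOpen {x : Fin d → ℝ | ∑ j, |x j| ^ r < 1} :=
    isOpen_lt (continuous_sum_abs_rpow hr) continuous_const
  refine (hopen.measure_pos volume ⟨0, ?_⟩).trans_le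
    (measure_mono fun x hx => (Set.mem_ofPred.1 hx).le)
  simp [Real.zero_rpow hr.ne']

theorem smul_mem_rBall {c : ℝ} (hc : 0 < c) {x : Fin d → ℝ} :
    x ∈ c • rBall d r ↔ ∑ j, |x j| ^ r ≤ c ^ r := by
  rw [Set.mem_smul_set_iff_inv_smul_mem₀ hc.ne', rBall, Set.mem_ofPred_eq,
    sum_abs_smul_rpow (inv_nonneg.2 hc.le), Real.inv_rpow hc.le,
    inv_mul_le_iff₀ (Real.rpow_pos_of_pos hc r), mul_one]

theorem volume_sphere_eq_zero (hr : 0 < r) :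
    volume {x : Fin d → ℝ | ∑ j, |x j| ^ r = 1} = 0 := by
  set S : Set (Fin d → ℝ) := {x | ∑ j, |x j| ^ r = 1}
  have hle : ∀ c ∈ Set.Ioo (0 : ℝ) 1,
      ENNReal.ofReal (c ^ d) * volume (rBall d r) + volume S ≤ volume (rBall d r) := fun c hc => by
    have hvol : volume (c • rBall d r) = ENNReal.ofReal (c ^ d) * volume (rBall d r) := by
      rw [Measure.addHaar_smul, Module.finrank_fin_fun, abs_of_pos (pow_pos hc.1 d)]
    have hlt : c ^ r < 1 := Real.rpow_lt_one hc.1.le hc.2 hr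
    rw [← hvol, ← measure_union]
    · refine measure_mono (Set.union_subset (fun x hx => ?_) fun x hx => le_of_eq hx)
      exact ((smul_mem_rBall hc.1).1 hx).trans hlt.le
    · refine Set.disjoint_left.2 fun x hx hxS => ?_
      exact absurd ((smul_mem_rBall hc.1).1 hx) (not_le.2 (hlt.trans_eq (Eq.symm hxS)))
    · exact (isClosed_eq (continuous_sum_abs_rpow hr) continuous_const).measurableSet
  have hlim : Tendsto (fun c : ℝ => ENNReal.ofReal (c ^ d) * volume (rBall d r) + volume S)
      (nhdsWithin 1 (Set.Iio 1))
      (nhds (ENNReal.ofReal (1 ^ d) * volume (rBall d r) + volume S)) := by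
    refine Tendsto.add_const _ (ENNReal.Tendsto.mul_const ?_ (Or.inr (volume_rBall_ne_top hr)))
    exact (ENNReal.continuous_ofReal.tendsto _).comp
      (((continuous_pow d).tendsto 1).mono_left nhdsWithin_le_nhds)
  have h1 := le_of_tendsto hlim (by
    filter_upwards [Ioo_mem_nhdsLT (zero_lt_one (α := ℝ))] with c hc using hle c hc)
  rw [one_pow, ENNReal.ofReal_one, one_mul] at h1
  exact le_zero_iff.1 ((ENNReal.add_le_add_iff_left (volume_rBall_ne_top hr)).1 (by simpa using h1))

theorem volume_frontier_rBall (hr : 0 < r) : volume (frontier (rBall d r)) = 0 :=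
  measure_mono_null (frontier_le_subset_eq (continuous_sum_abs_rpow hr) continuous_const)
    (volume_sphere_eq_zero hr)

/-- The integer points in the `ℓ^r` ball of radius `R`. -/
def latticeBall (d : ℕ) (r R : ℝ) : Set (ZLat d) := {k | ∑ j, |(k j : ℝ)| ^ r ≤ R ^ r}

theorem finite_latticeBall (hr : 0 < r) {R : ℝ} (hR : 0 ≤ R) : (latticeBall d r R).Finite := by
  refine (Set.finite_Icc (fun _ => -⌈R⌉ : ZLat d) fun _ => ⌈R⌉).subset fun k hk => ?_
  have h : ∀ j, |k j| ≤ ⌈R⌉ := fun j => by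
    have h1 := abs_le_of_sum_abs_rpow_le (x := fun j => (k j : ℝ)) hr hR hk j
    exact_mod_cast h1.trans (Int.le_ceil R)
  exact ⟨fun j => (abs_le.1 (h j)).1, fun j => (abs_le.1 (h j)).2⟩

theorem natCard_rBall_inter {R : ℝ} (hR : 0 < R) :
    Nat.card ↑(rBall d r ∩
      R⁻¹ • (Submodule.span ℤ (Set.range (Pi.basisFun ℝ (Fin d))) : Set (Fin d → ℝ))) =
      (latticeBall d r R).ncard := by
  have himage : rBall d r ∩
      R⁻¹ • (Submodule.span ℤ (Set.range (Pi.basisFun ℝ (Fin d))) : Set (Fin d → ℝ)) =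
      (fun k : ZLat d => R⁻¹ • fun j => (k j : ℝ)) '' latticeBall d r R := by
    ext x
    simp only [Set.mem_inter_iff, Set.mem_image, Set.mem_smul_set, SetLike.mem_coe,
      Module.Basis.mem_span_iff_repr_mem, Pi.basisFun_repr]
    have hiff : ∀ y : Fin d → ℝ, R⁻¹ • y ∈ rBall d r ↔ ∑ j, |y j| ^ r ≤ R ^ r := fun y => by
      rw [← smul_mem_rBall hR, Set.mem_smul_set_iff_inv_smul_mem₀ hR.ne']
    constructor
    · rintro ⟨hx, y, hy, rfl⟩
      choose k hk using hy
      obtain rfl : (fun j => (k j : ℝ)) = y := funext hk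
      exact ⟨k, (hiff _).1 hx, rfl⟩
    · rintro ⟨k, hk, rfl⟩
      exact ⟨(hiff _).2 hk, _, fun j => ⟨k j, rfl⟩, rfl⟩
  rw [himage, Nat.card_coe_set_eq, Set.ncard_image_of_injective]
  intro k l hkl
  have h := smul_right_injective _ (inv_ne_zero hR.ne') hkl
  exact funext fun j => by exact_mod_cast congrFun h j

theorem tendsto_ncard_latticeBall (d : ℕ) (hr : 0 < r) :
    Tendsto (fun R : ℝ => ((latticeBall d r R).ncard : ℝ) / R ^ d) atTop
      (nhds (volume (rBall d r)).toReal) := by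
  have h := tendsto_card_div_pow_atTop_volume' (rBall d r) (isBounded_rBall hr)
    (isClosed_rBall hr).measurableSet (volume_frontier_rBall hr) fun a b ha hab x hx => by
      rw [smul_mem_rBall ha] at hx
      rw [smul_mem_rBall (ha.trans_le hab)]
      exact hx.trans (Real.rpow_le_rpow ha.le hab hr.le)
  rw [Fintype.card_fin] at h
  refine h.congr' ?_
  filter_upwards [eventually_gt_atTop 0] with R hR
  rw [natCard_rBall_inter hR]

end LatticeCount

section Asymptotics

variable {d : ℕ} {s r : ℝ}

/-- The radius `R` at which `a * R ^ d = n`. -/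
def criticalRadius (d : ℕ) (a : ℝ) (n : ℕ) : ℝ := ((n : ℝ) / a) ^ (d : ℝ)⁻¹

theorem criticalRadius_pos {a : ℝ} (ha : 0 < a) {n : ℕ} (hn : 0 < n) :
    0 < criticalRadius d a n := by
  unfold criticalRadius
  positivity

theorem criticalRadius_pow (hd : 0 < d) {a : ℝ} (ha : 0 ≤ a) (n : ℕ) :
    criticalRadius d a n ^ d = n / a :=
  Real.rpow_inv_natCast_pow (by positivity) hd.ne'

theorem tendsto_criticalRadius (hd : 0 < d) {a : ℝ} (ha : 0 < a) :
    Tendsto (criticalRadius d a) atTop atTop :=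
  (tendsto_rpow_atTop (by positivity)).comp (tendsto_natCast_atTop_atTop.atTop_div_const ha)

theorem criticalWeight_pos {R : ℝ} (hR : 0 ≤ R) : 0 < (1 + R ^ r) ^ (s / r) := by
  positivity

theorem one_le_wIso (hs : 0 < s) (hr : 0 < r) (k : ZLat d) : 1 ≤ wIso d s r k := by
  refine Real.one_le_rpow (le_add_of_nonneg_right ?_) (by positivity)
  positivity

theorem wIso_le (hs : 0 < s) (hr : 0 < r) {R : ℝ} {k : ZLat d} (hk : k ∈ latticeBall d r R) :
    wIso d s r k ≤ (1 + R ^ r) ^ (s / r) :=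
  Real.rpow_le_rpow (by positivity) (add_le_add_right hk 1) (by positivity)

theorem le_wIso (hs : 0 < s) (hr : 0 < r) {R : ℝ} (hR : 0 ≤ R) {k : ZLat d}
    (hk : k ∉ latticeBall d r R) : (1 + R ^ r) ^ (s / r) ≤ wIso d s r k :=
  Real.rpow_le_rpow (by positivity) (add_le_add_right (le_of_not_ge hk) 1) (by positivity)

theorem tendsto_rpow_mul_inv_criticalWeight (hd : 0 < d) (hr : 0 < r) {a : ℝ}
    (ha : 0 < a) :
    Tendsto (fun n : ℕ => (n : ℝ) ^ (s / (d : ℝ)) *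
      ((1 + criticalRadius d a n ^ r) ^ (s / r))⁻¹) atTop (nhds (a ^ (s / (d : ℝ)))) := by
  have h1 : Tendsto (fun R : ℝ => 1 - (1 + R ^ r)⁻¹) atTop (nhds 1) := by
    simpa using (tendsto_inv_atTop_zero.comp
      (tendsto_atTop_add_const_left _ 1 (tendsto_rpow_atTop hr))).const_sub 1
  have h2 : Tendsto (fun R : ℝ => a ^ (s / (d : ℝ)) * (1 - (1 + R ^ r)⁻¹) ^ (s / r)) atTop
      (nhds (a ^ (s / (d : ℝ)))) := by
    simpa using (h1.rpow_const (p := s / r) (Or.inl one_ne_zero)).const_mul (a ^ (s / (d : ℝ)))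
  refine (h2.comp (tendsto_criticalRadius hd ha)).congr' ?_
  filter_upwards [eventually_gt_atTop 0] with n hn
  have hR := criticalRadius_pos (d := d) ha hn
  have hnR : (n : ℝ) = a * criticalRadius d a n ^ (d : ℝ) := by
    rw [Real.rpow_natCast, criticalRadius_pow hd ha.le, mul_div_cancel₀ _ ha.ne']
  have hd' : (d : ℝ) ≠ 0 := by positivity
  have hn' : (n : ℝ) ^ (s / (d : ℝ)) =
      a ^ (s / (d : ℝ)) * (criticalRadius d a n ^ r) ^ (s / r) := by
    conv_lhs => rw [hnR]
    rw [Real.mul_rpow ha.le (by positivity), ← Real.rpow_mul hR.le, ← Real.rpow_mul hR.le,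
      mul_div_cancel₀ _ hd', mul_div_cancel₀ _ hr.ne']
  have hq : 1 - (1 + criticalRadius d a n ^ r)⁻¹ =
      criticalRadius d a n ^ r / (1 + criticalRadius d a n ^ r) := by
    have : 1 + criticalRadius d a n ^ r ≠ 0 := by positivity
    field_simp
    ring
  rw [Function.comp_apply, hn', hq, Real.div_rpow (by positivity) (by positivity), ← mul_div_assoc,
    ← div_eq_mul_inv]

end Asymptotics

/-- Proposition 1 of Cobos–Kühn–Sickel. For fixed `d`, `s > 0` and
`0 < r < ∞`, `lim_{n→∞} n^{s/d} a_n(I_d : H^{s,r}(𝕋^d) → L₂(𝕋^d)) = vol(B_r^d)^{s/d}`.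
The embedding `I_d` is modelled as any operator `T : ℓ² → L₂(𝕋^d)` (with `ℓ²` the
isometric model of `H^{s,r}(𝕋^d)`) such that `T c` has Fourier coefficients
`c(k)/w_{s,r}(k)`. -/
theorem statement4 (d : ℕ) (hd : 0 < d) (s r : ℝ) (hs : 0 < s) (hr : 0 < r) :
    (∃ T : ellTwo d →L[ℂ] Lp ℂ 2 (torusMeasure d),
        ∀ (c : ellTwo d) (k : ZLat d), fourierCoef (⇑(T c)) k = c k / (wIso d s r k : ℂ)) ∧
    ∀ T : ellTwo d →L[ℂ] Lp ℂ 2 (torusMeasure d),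
      (∀ (c : ellTwo d) (k : ZLat d), fourierCoef (⇑(T c)) k = c k / (wIso d s r k : ℂ)) →
      Tendsto (fun n : ℕ => (n : ℝ) ^ (s / (d : ℝ)) * approxNum T n) atTop
        (nhds ((volume {x : Fin d → ℝ | ∑ j, |x j| ^ r ≤ 1}).toReal ^ (s / (d : ℝ)))) := by
  have hw : ∀ k, 1 ≤ wIso d s r k := one_le_wIso hs hr
  constructor
  · obtain ⟨D, hD⟩ := exists_diagonal_operator hw
    refine ⟨((torusBasis d).repr.symm.toContinuousLinearEquiv : _ →L[ℂ] _).comp D, fun c k => ?_⟩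
    rw [← torusBasis_repr, ← hD]
    exact congrArg (fun c' : ellTwo d => c' k) ((torusBasis d).repr.apply_symm_apply (D c))
  intro T hT
  change Tendsto _ _ (nhds ((volume (rBall d r)).toReal ^ (s / (d : ℝ))))
  have hTJ : ∀ c k, (torusBasis d).repr.toLinearIsometry (T c) k = c k / (wIso d s r k : ℂ) :=
    fun c k => (torusBasis_repr (T c) k).trans (hT c k)
  have hV : 0 < (volume (rBall d r)).toReal :=
    ENNReal.toReal_pos (volume_rBall_pos hr).ne' (volume_rBall_ne_top hr)
  set V := (volume (rBall d r)).toReal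
  have hcont : ContinuousAt (fun a : ℝ => a ^ (s / (d : ℝ))) V :=
    Real.continuousAt_rpow_const _ _ (Or.inl hV.ne')
  rw [tendsto_order]
  constructor
  · intro l hl
    obtain ⟨a, ⟨hal, ha⟩, haV⟩ := ((((hcont.eventually (lt_mem_nhds hl)).and
      (lt_mem_nhds hV)).filter_mono nhdsWithin_le_nhds).and
        (self_mem_nhdsWithin (s := Set.Iio V))).exists
    filter_upwards [(tendsto_rpow_mul_inv_criticalWeight hd hr ha).eventually (lt_mem_nhds hal),
      (tendsto_criticalRadius hd ha).eventually
        ((tendsto_ncard_latticeBall d hr).eventually (lt_mem_nhds haV)),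
      eventually_gt_atTop 0] with n hn hcard hn0
    refine hn.trans_le (mul_le_mul_of_nonneg_left ?_ (by positivity))
    have hR := criticalRadius_pos (d := d) ha hn0
    rw [criticalRadius_pow hd ha.le, lt_div_iff₀ (by positivity),
      mul_div_cancel₀ _ ha.ne', Nat.cast_lt,
      Set.ncard_eq_toFinset_card _ (finite_latticeBall hr hR.le)] at hcard
    exact inv_le_approxNum (fun k => zero_lt_one.trans_le (hw k)) hTJ
      (criticalWeight_pos hR.le) hn0 hcard.le
      fun k hk => wIso_le hs hr ((Set.Finite.mem_toFinset _).1 hk)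
  · intro u hu
    obtain ⟨b, hbu, hbV⟩ := (((hcont.eventually (gt_mem_nhds hu)).filter_mono
      nhdsWithin_le_nhds).and (self_mem_nhdsWithin (s := Set.Ioi V))).exists
    have hb : 0 < b := hV.trans hbV
    filter_upwards [(tendsto_rpow_mul_inv_criticalWeight hd hr hb).eventually (gt_mem_nhds hbu),
      (tendsto_criticalRadius hd hb).eventually
        ((tendsto_ncard_latticeBall d hr).eventually (gt_mem_nhds hbV)),
      eventually_gt_atTop 0] with n hn hcard hn0
    refine (mul_le_mul_of_nonneg_left ?_ (by positivity)).trans_lt hn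
    have hR := criticalRadius_pos (d := d) hb hn0
    rw [criticalRadius_pow hd hb.le, div_lt_iff₀ (by positivity),
      mul_div_cancel₀ _ hb.ne', Nat.cast_lt,
      Set.ncard_eq_toFinset_card _ (finite_latticeBall hr hR.le)] at hcard
    refine approxNum_le_inv hTJ (criticalWeight_pos hR.le) hcard fun k hk => ?_
    exact le_wIso hs hr hR.le fun hmem => hk ((Set.Finite.mem_toFinset _).2 hmem)
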